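/- Let n ≥ 1 be an integer and ρ ≥ 0 a real number. Then ∫_ℝ [ n·Φ( λ/√(1+ρ²) ) + n·(n−1)·( Φ( λ/√(1+ρ²) ) )² ]·φ(λ) dλ = n²/2 − ((n²−n)/π)·arctan( √( (1+ρ²)/(3+ρ²) ) ). Equivalently, if X ~ N(0,1) and, conditionally on X = λ, Y is Binomial(n, Φ(λ/√(1+ρ²)))-distributed, then E[Y²] equals the right-hand side. -/

import Mathlib

open MeasureTheory Real

/-- The standard normal density. -/
noncomputable def stdNormalPDF (x : ℝ) : ℝ :=
  (1 / Real.sqrt (2 * Real.pi)) * Real.exp (-x^2 / 2)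

/-- The standard normal cumulative distribution function. -/
noncomputable def stdNormalCDF (x : ℝ) : ℝ :=
  ∫ t in Set.Iic x, stdNormalPDF t

lemma stdNormalPDF_nonneg (x : ℝ) : 0 ≤ stdNormalPDF x := by
  unfold stdNormalPDF
  positivity

lemma stdNormalPDF_le_one (x : ℝ) : stdNormalPDF x ≤ 1 := by
  unfold stdNormalPDF
  have h1 : (1 : ℝ) ≤ √(2 * π) := by
    rw [Real.one_le_sqrt]
    linarith [Real.pi_gt_three]
  have h2 : 1 / √(2 * π) ≤ 1 := by
    rw [div_le_one (by linarith)]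
    exact h1
  have h3 : Real.exp (-x ^ 2 / 2) ≤ 1 := Real.exp_le_one_iff.2 (by nlinarith [sq_nonneg x])
  exact mul_le_one₀ h2 (Real.exp_pos _).le h3

lemma continuous_stdNormalPDF : Continuous stdNormalPDF := by
  unfold stdNormalPDF
  fun_prop

lemma stdNormalPDF_neg (x : ℝ) : stdNormalPDF (-x) = stdNormalPDF x := by
  simp [stdNormalPDF]

lemma stdNormalPDF_eq_const_mul_exp :
    stdNormalPDF = fun x => (1 / √(2 * π)) * Real.exp (-(1 / 2) * x ^ 2) := by
  ext x
  unfold stdNormalPDF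
  ring_nf

lemma integrable_stdNormalPDF : Integrable stdNormalPDF := by
  rw [stdNormalPDF_eq_const_mul_exp]
  exact (integrable_exp_neg_mul_sq (by norm_num)).const_mul _

lemma integrable_mul_stdNormalPDF : Integrable fun x => x * stdNormalPDF x := by
  rw [stdNormalPDF_eq_const_mul_exp]
  convert (integrable_mul_exp_neg_mul_sq (b := 1 / 2) (by norm_num)).const_mul (1 / √(2 * π))
    using 2
  ring

lemma integral_stdNormalPDF : ∫ x, stdNormalPDF x = 1 := by
  rw [stdNormalPDF_eq_const_mul_exp, integral_const_mul, integral_gaussian,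
    show π / (1 / 2) = 2 * π by ring]
  exact one_div_mul_cancel (by positivity)

lemma hasDerivAt_stdNormalPDF (x : ℝ) : HasDerivAt stdNormalPDF (-x * stdNormalPDF x) x := by
  unfold stdNormalPDF
  refine ((((hasDerivAt_id x).pow 2).neg.div_const 2).exp.const_mul
    (1 / √(2 * π))).congr_deriv ?_
  simp
  ring

lemma stdNormalCDF_nonneg (x : ℝ) : 0 ≤ stdNormalCDF x :=
  integral_nonneg stdNormalPDF_nonneg

lemma stdNormalCDF_le_one (x : ℝ) : stdNormalCDF x ≤ 1 := by
  rw [← integral_stdNormalPDF]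
  exact setIntegral_le_integral integrable_stdNormalPDF (.of_forall stdNormalPDF_nonneg)

lemma stdNormalCDF_neg (x : ℝ) : stdNormalCDF (-x) = 1 - stdNormalCDF x := by
  have h := integral_comp_neg_Iic (-x) stdNormalPDF
  simp only [stdNormalPDF_neg, neg_neg] at h
  have h2 := intervalIntegral.integral_Iic_add_Ioi (b := x)
    integrable_stdNormalPDF.integrableOn integrable_stdNormalPDF.integrableOn
  rw [integral_stdNormalPDF] at h2
  unfold stdNormalCDF
  linarith

lemma stdNormalCDF_zero : stdNormalCDF 0 = 1 / 2 := by
  have h := stdNormalCDF_neg 0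
  rw [neg_zero] at h
  linarith

lemma hasDerivAt_stdNormalCDF (x : ℝ) : HasDerivAt stdNormalCDF (stdNormalPDF x) x := by
  have h : stdNormalCDF = fun y => stdNormalCDF 0 + ∫ t in (0 : ℝ)..y, stdNormalPDF t := by
    ext y
    rw [← intervalIntegral.integral_Iic_sub_Iic integrable_stdNormalPDF.integrableOn
      integrable_stdNormalPDF.integrableOn]
    unfold stdNormalCDF
    ring
  rw [h]
  exact (intervalIntegral.integral_hasDerivAt_right
    integrable_stdNormalPDF.intervalIntegrable
    (continuous_stdNormalPDF.stronglyMeasurableAtFilter _ _)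
    continuous_stdNormalPDF.continuousAt).const_add _

lemma continuous_stdNormalCDF : Continuous stdNormalCDF :=
  continuous_iff_continuousAt.2 fun x => (hasDerivAt_stdNormalCDF x).continuousAt

lemma integrable_stdNormalCDF_pow_mul_stdNormalPDF (k : ℕ) (c : ℝ) :
    Integrable fun l => stdNormalCDF (c * l) ^ k * stdNormalPDF l := by
  refine integrable_stdNormalPDF.bdd_mul (c := 1) ?_ (.of_forall fun l => ?_)
  · exact ((continuous_stdNormalCDF.comp (by fun_prop)).pow k).aestronglyMeasurable
  · rw [Real.norm_of_nonneg (pow_nonneg (stdNormalCDF_nonneg _) _)]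
    exact pow_le_one₀ (stdNormalCDF_nonneg _) (stdNormalCDF_le_one _)

lemma integral_stdNormalCDF_mul_stdNormalPDF (c : ℝ) :
    ∫ l, stdNormalCDF (c * l) * stdNormalPDF l = 1 / 2 := by
  have hi : Integrable fun l => stdNormalCDF (c * l) * stdNormalPDF l := by
    simpa using integrable_stdNormalCDF_pow_mul_stdNormalPDF 1 c
  have h := integral_neg_eq_self (fun l => stdNormalCDF (c * l) * stdNormalPDF l) volume
  simp only [mul_neg, stdNormalCDF_neg, stdNormalPDF_neg, sub_mul, one_mul] at h
  rw [integral_sub integrable_stdNormalPDF hi, integral_stdNormalPDF] at h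
  linarith

lemma integral_stdNormalPDF_sq_mul_stdNormalPDF (c : ℝ) :
    ∫ l, stdNormalPDF (c * l) ^ 2 * stdNormalPDF l = 1 / (2 * π * √(1 + 2 * c ^ 2)) := by
  have h : (fun l => stdNormalPDF (c * l) ^ 2 * stdNormalPDF l) =
      fun l => (1 / √(2 * π)) ^ 3 * Real.exp (-((1 + 2 * c ^ 2) / 2) * l ^ 2) := by
    ext l
    unfold stdNormalPDF
    rw [mul_pow, ← Real.exp_nat_mul,
      show -((1 + 2 * c ^ 2) / 2) * l ^ 2 = (2 : ℕ) * (-(c * l) ^ 2 / 2) + -l ^ 2 / 2 by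
        push_cast; ring, Real.exp_add]
    ring
  rw [h, integral_const_mul, integral_gaussian,
    show π / ((1 + 2 * c ^ 2) / 2) = 2 * π / (1 + 2 * c ^ 2) by field_simp,
    Real.sqrt_div (by positivity)]
  have h1 : √(2 * π) ^ 2 = 2 * π := Real.sq_sqrt (by positivity)
  have h2 : 0 < √(2 * π) := by positivity
  have h3 : 0 < √(1 + 2 * c ^ 2) := by positivity
  rw [← h1, Real.sqrt_sq h2.le]
  field_simp

lemma integrable_mul_of_abs_le_one {f g : ℝ → ℝ} (hf : Continuous f)
    (hf1 : ∀ x, |f x| ≤ 1) (hg : Integrable g) : Integrable fun l => f l * g l :=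
  hg.bdd_mul (c := 1) hf.aestronglyMeasurable (.of_forall hf1)

lemma integral_stdNormalCDF_mul_stdNormalPDF_mul_id (c : ℝ) :
    ∫ l, stdNormalCDF (c * l) * (stdNormalPDF (c * l) * (l * stdNormalPDF l)) =
      c / ((1 + c ^ 2) * (2 * π * √(1 + 2 * c ^ 2))) := by
  have hpdf : Continuous fun l => stdNormalPDF (c * l) :=
    continuous_stdNormalPDF.comp (by fun_prop)
  have hcdf : Continuous fun l => stdNormalCDF (c * l) :=
    continuous_stdNormalCDF.comp (by fun_prop)
  have hpdf1 (l : ℝ) : |stdNormalPDF (c * l)| ≤ 1 := by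
    rw [abs_of_nonneg (stdNormalPDF_nonneg _)]
    exact stdNormalPDF_le_one _
  have hcdf1 (l : ℝ) : |stdNormalCDF (c * l)| ≤ 1 := by
    rw [abs_of_nonneg (stdNormalCDF_nonneg _)]
    exact stdNormalCDF_le_one _
  have hmul (l : ℝ) : HasDerivAt (fun l => c * l) c l := by
    simpa using (hasDerivAt_id l).const_mul c
  have hc : (1 + c ^ 2) ≠ 0 := by positivity
  have hv : Integrable fun l => -(1 / (1 + c ^ 2)) * (stdNormalPDF (c * l) * stdNormalPDF l) :=
    (integrable_mul_of_abs_le_one hpdf hpdf1 integrable_stdNormalPDF).const_mul _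
  rw [integral_mul_deriv_eq_deriv_mul_of_integrable
    (u := fun l => stdNormalCDF (c * l)) (u' := fun l => stdNormalPDF (c * l) * c)
    (v := fun l => -(1 / (1 + c ^ 2)) * (stdNormalPDF (c * l) * stdNormalPDF l))
    (fun l _ => (hasDerivAt_stdNormalCDF (c * l)).comp l (hmul l)) (fun l _ => ?_) ?_ ?_ ?_]
  · rw [← integral_neg]
    have h : (fun l => -(stdNormalPDF (c * l) * c *
        (-(1 / (1 + c ^ 2)) * (stdNormalPDF (c * l) * stdNormalPDF l)))) =
        fun l => (c / (1 + c ^ 2)) * (stdNormalPDF (c * l) ^ 2 * stdNormalPDF l) := by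
      ext l
      ring
    rw [h, integral_const_mul, integral_stdNormalPDF_sq_mul_stdNormalPDF, div_mul_div_comm,
      mul_one]
  · exact integrable_mul_of_abs_le_one hcdf hcdf1
      (integrable_mul_of_abs_le_one hpdf hpdf1 integrable_mul_stdNormalPDF)
  · convert (integrable_mul_of_abs_le_one hpdf hpdf1 hv).const_mul c using 2
    simp only [Pi.mul_apply]
    ring
  · exact integrable_mul_of_abs_le_one hcdf hcdf1 hv
  · refine ((((hasDerivAt_stdNormalPDF (c * l)).comp l (hmul l)).mul
      (hasDerivAt_stdNormalPDF l)).const_mul (-(1 / (1 + c ^ 2)))).congr_deriv ?_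
    simp only [Function.comp_apply]
    field_simp
    ring

lemma hasDerivAt_integral_stdNormalCDF_sq (c : ℝ) :
    HasDerivAt (fun c => ∫ l, stdNormalCDF (c * l) ^ 2 * stdNormalPDF l)
      (c / (π * (1 + c ^ 2) * √(1 + 2 * c ^ 2))) c := by
  have key := (hasDerivAt_integral_of_dominated_loc_of_deriv_le (μ := volume)
    (F := fun c l => stdNormalCDF (c * l) ^ 2 * stdNormalPDF l)
    (F' := fun c l => 2 * (stdNormalCDF (c * l) * (stdNormalPDF (c * l) * (l * stdNormalPDF l))))
    (x₀ := c) (s := Set.univ) (bound := fun l => 2 * |l * stdNormalPDF l|) Filter.univ_mem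
    (.of_forall fun x =>
      (integrable_stdNormalCDF_pow_mul_stdNormalPDF 2 x).aestronglyMeasurable)
    (integrable_stdNormalCDF_pow_mul_stdNormalPDF 2 c) ?_
    (.of_forall fun l x _ => ?_) (integrable_mul_stdNormalPDF.abs.const_mul 2)
    (.of_forall fun l x _ => ?_)).2
  · rw [integral_const_mul, integral_stdNormalCDF_mul_stdNormalPDF_mul_id] at key
    refine key.congr_deriv ?_
    field_simp
  · refine Continuous.aestronglyMeasurable ?_
    have := continuous_stdNormalPDF
    have := continuous_stdNormalCDF
    fun_prop
  · rw [Real.norm_eq_abs, abs_mul, abs_mul, abs_mul, abs_two,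
      abs_of_nonneg (stdNormalPDF_nonneg _), abs_of_nonneg (stdNormalCDF_nonneg _)]
    gcongr
    calc _ ≤ 1 * (1 * |l * stdNormalPDF l|) := by
          gcongr
          · exact mul_nonneg (stdNormalPDF_nonneg _) (abs_nonneg _)
          · exact stdNormalCDF_le_one _
          · exact stdNormalPDF_le_one _
      _ = _ := by ring
  · have hmul : HasDerivAt (fun c => c * l) l x := by
      simpa using (hasDerivAt_id x).mul_const l
    refine ((((hasDerivAt_stdNormalCDF (x * l)).comp x hmul).pow 2).mul_const
      (stdNormalPDF l)).congr_deriv ?_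
    simp only [Function.comp_apply]
    ring

lemma hasDerivAt_arctan_inv_sqrt (c : ℝ) :
    HasDerivAt (fun c => 1 / 2 - 1 / π * Real.arctan (√(1 + 2 * c ^ 2))⁻¹)
      (c / (π * (1 + c ^ 2) * √(1 + 2 * c ^ 2))) c := by
  have hpos : 0 < 1 + 2 * c ^ 2 := by positivity
  have hs : 0 < √(1 + 2 * c ^ 2) := by positivity
  have hsq : √(1 + 2 * c ^ 2) ^ 2 = 1 + 2 * c ^ 2 := Real.sq_sqrt hpos.le
  have hpoly : HasDerivAt (fun c : ℝ => 1 + 2 * c ^ 2) (4 * c) c := by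
    refine ((((hasDerivAt_id c).pow 2).const_mul 2).const_add 1).congr_deriv ?_
    simp
    ring
  refine (((((hpoly.sqrt hpos.ne').inv hs.ne').arctan).const_mul (1 / π)).const_sub
    (1 / 2)).congr_deriv ?_
  simp only [Pi.inv_apply, inv_pow, hsq]
  field_simp
  ring

/-- The second moment of `Φ(cX)` for a standard normal variable `X`. -/
lemma integral_stdNormalCDF_sq_mul_stdNormalPDF (c : ℝ) :
    ∫ l, stdNormalCDF (c * l) ^ 2 * stdNormalPDF l =
      1 / 2 - 1 / π * Real.arctan (√(1 + 2 * c ^ 2))⁻¹ := by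
  have hd (x : ℝ) := (hasDerivAt_integral_stdNormalCDF_sq x).sub (hasDerivAt_arctan_inv_sqrt x)
  have h := is_const_of_deriv_eq_zero (fun x => (hd x).differentiableAt)
    (fun x => by rw [(hd x).deriv, sub_self]) c 0
  simp only [Pi.sub_apply, zero_mul, stdNormalCDF_zero, integral_const_mul,
    integral_stdNormalPDF] at h
  have hz : 1 / 2 - 1 / π * Real.arctan (√(1 + 2 * (0 : ℝ) ^ 2))⁻¹ = 1 / 4 := by
    simp [Real.arctan_one]
    field_simp
    norm_num
  rw [hz] at h
  linarith

/-- The second moment of the number of wins in `n` rounds: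
`∫ (n Φ(λ/√(1+ρ²)) + n(n−1) Φ(λ/√(1+ρ²))²) φ(λ) dλ
  = n²/2 − ((n²−n)/π) arctan √((1+ρ²)/(3+ρ²))`. -/
theorem second_moment_win_count (n : ℕ) (hn : 1 ≤ n) (ρ : ℝ) (hρ : 0 ≤ ρ) :
    (∫ l : ℝ, ((n : ℝ) * stdNormalCDF (l / Real.sqrt (1 + ρ^2))
        + (n : ℝ) * ((n : ℝ) - 1) * (stdNormalCDF (l / Real.sqrt (1 + ρ^2)))^2)
        * stdNormalPDF l)
      = (n : ℝ)^2 / 2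
        - (((n : ℝ)^2 - (n : ℝ)) / Real.pi)
          * Real.arctan (Real.sqrt ((1 + ρ^2) / (3 + ρ^2))) := by
  set c : ℝ := (√(1 + ρ ^ 2))⁻¹ with hc
  have h1 : Integrable fun l => stdNormalCDF (c * l) * stdNormalPDF l := by
    simpa using integrable_stdNormalCDF_pow_mul_stdNormalPDF 1 c
  have h2 := integrable_stdNormalCDF_pow_mul_stdNormalPDF 2 c
  have hint : (fun l : ℝ => ((n : ℝ) * stdNormalCDF (l / √(1 + ρ ^ 2))
        + (n : ℝ) * ((n : ℝ) - 1) * (stdNormalCDF (l / √(1 + ρ ^ 2))) ^ 2) * stdNormalPDF l) =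
      fun l => (n : ℝ) * (stdNormalCDF (c * l) * stdNormalPDF l)
        + ((n : ℝ) * ((n : ℝ) - 1)) * (stdNormalCDF (c * l) ^ 2 * stdNormalPDF l) := by
    ext l
    rw [show l / √(1 + ρ ^ 2) = c * l by rw [hc, div_eq_inv_mul]]
    ring
  have hsqrt : √((1 + ρ ^ 2) / (3 + ρ ^ 2)) = (√(1 + 2 * c ^ 2))⁻¹ := by
    rw [← Real.sqrt_inv, hc, inv_pow, Real.sq_sqrt (by positivity)]
    congr 1
    field_simp
    ring
  rw [hint, integral_add (h1.const_mul _) (h2.const_mul _), integral_const_mul,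
    integral_const_mul, integral_stdNormalCDF_mul_stdNormalPDF,
    integral_stdNormalCDF_sq_mul_stdNormalPDF, hsqrt]
  ring
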